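/- arXiv:0804.4772 — 4 statements merged into one kernel-verified Lean document; each statement's English description precedes it below -/
import Mathlib

section
/- Let V be a finite-dimensional vector space over the field Z/2 and let B be a symmetric bilinear form on V with values in Z/2. Then there exists a quadratic enhancement q : V → Z/4 of B. -/
/-- The injective group homomorphism `ZMod 2 → ZMod 4` sending `1` to `2`. -/
def twoMul : ZMod 2 → ZMod 4 := fun a => 2 * (a.val : ZMod 4)

/-- `twoMul` as an additive homomorphism. -/
def twoMulHom : ZMod 2 →+ ZMod 4 where
  toFun := twoMul
  map_zero' := by decide
  map_add' := by unfold twoMul; decide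

theorem twoMul_mul3 : ∀ a b c : ZMod 2, twoMul (a * (b * c)) =
    2 * ((a.val : ZMod 4) * ((c.val : ZMod 4) * (b.val : ZMod 4))) := by
  unfold twoMul; decide

theorem lift_add : ∀ a b : ZMod 2, ((a + b).val : ZMod 4) =
    a.val + b.val + 2 * (a.val * b.val : ZMod 4) := by
  decide

/-- Every symmetric bilinear form over `ZMod 2` on a finite-dimensional space admits
a quadratic enhancement `q : V → ZMod 4`. -/
theorem stmt_9 {V : Type*} [AddCommGroup V] [Module (ZMod 2) V]
    [FiniteDimensional (ZMod 2) V]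
    (B : LinearMap.BilinForm (ZMod 2) V) (hB : ∀ x y, B x y = B y x) :
    ∃ q : V → ZMod 4, ∀ x y, q (x + y) = q x + q y + twoMul (B x y) := by
  classical
  let b := Module.finBasis (ZMod 2) V
  let l : V → (Fin (Module.finrank (ZMod 2) V) → ZMod 4) := fun x i => ((b.repr x i).val : ZMod 4)
  let L : (Fin (Module.finrank (ZMod 2) V) → ZMod 4) →
      (Fin (Module.finrank (ZMod 2) V) → ZMod 4) → ZMod 4 :=
    fun u v => ∑ i, ∑ j, u i * (v j * ((B (b i) (b j)).val : ZMod 4))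
  have hs : ∀ u v, L u v = L v u := by
    intro u v
    simp only [L]
    rw [Finset.sum_comm]
    refine Finset.sum_congr rfl fun i _ => Finset.sum_congr rfl fun j _ => ?_
    rw [hB (b j) (b i)]; ring
  have ha : ∀ u v w, L (u + v) w = L u w + L v w := by
    intro u v w
    simp only [L, Pi.add_apply, add_mul, Finset.sum_add_distrib]
  have ha' : ∀ u v w, L w (u + v) = L w u + L w v := by
    intro u v w
    rw [hs, ha, hs u, hs v]
  have hl : ∀ x y, l (x + y) = l x + l y + (l x * l y + l x * l y) := by
    intro x y
    funext i
    simp only [l, Pi.add_apply, Pi.mul_apply, map_add, Finsupp.add_apply, lift_add]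
    ring
  have hT : ∀ x y, twoMul (B x y) = 2 * L (l x) (l y) := by
    intro x y
    have h : B x y = ∑ i, ∑ j, b.repr x i * (b.repr y j * B (b i) (b j)) := by
      conv_lhs => rw [← b.sum_repr x, ← b.sum_repr y]
      simp only [map_sum, LinearMap.sum_apply, map_smul, LinearMap.smul_apply, smul_eq_mul,
        Finset.mul_sum]
      rw [Finset.sum_comm]
      refine Finset.sum_congr rfl fun i _ => Finset.sum_congr rfl fun j _ => ?_
      ring
    change twoMulHom (B x y) = _
    rw [h]
    simp only [map_sum, L, Finset.mul_sum]
    refine Finset.sum_congr rfl fun i _ => Finset.sum_congr rfl fun j _ => ?_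
    change twoMul _ = _
    rw [twoMul_mul3]
    simp only [l]
    ring
  refine ⟨fun x => L (l x) (l x), fun x y => ?_⟩
  simp only [hl, hT, ha, ha']
  generalize l x * l y = c
  rw [hs (l y) (l x), hs c (l x), hs c (l y)]
  have h4 : (4 : ZMod 4) = 0 := by decide
  linear_combination (L (l x) c + L (l y) c + L c c) * h4
end

section
/- Let V be a finite-dimensional vector space over the field Z/2 with finitely many elements, let B be a symmetric bilinear form on V with values in Z/2, let q be a quadratic form refining B, and let c ∈ V. Then Σ_{x ∈ V} (−1)^{q(x) + B(c,x)} = (−1)^{q(c)} · Σ_{x ∈ V} (−1)^{q(x)}, as an identity of integers, where (−1)^a for a ∈ Z/2 is the well-defined sign obtained by lifting a to {0,1}. -/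
/-- The sign `(-1)^a` associated to `a : ZMod 2`, lifting `a` to `{0, 1}`. -/
def signZMod2 : ZMod 2 → ℤ := fun a => (-1) ^ a.val

/-- Gauss-sum identity for a quadratic form `q` refining a symmetric bilinear form
`B` over `ZMod 2`: `Σ_x (-1)^(q x + B c x) = (-1)^(q c) · Σ_x (-1)^(q x)`. -/
theorem stmt_11 {V : Type*} [AddCommGroup V] [Module (ZMod 2) V]
    [FiniteDimensional (ZMod 2) V] [Fintype V]
    (B : LinearMap.BilinForm (ZMod 2) V) (hB : ∀ x y, B x y = B y x)
    (q : V → ZMod 2) (hq : ∀ x y, q (x + y) = q x + q y + B x y) (c : V) :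
    ∑ x : V, signZMod2 (q x + B c x) = signZMod2 (q c) * ∑ x : V, signZMod2 (q x) := by
  have hmul : ∀ a b : ZMod 2, signZMod2 a * signZMod2 (a + b) = signZMod2 b := by
    unfold signZMod2
    decide
  rw [← Equiv.sum_comp (Equiv.addLeft c) (fun x => signZMod2 (q x)), Finset.mul_sum]
  refine Finset.sum_congr rfl fun x _ => ?_
  simp only [Equiv.coe_addLeft]
  rw [hq, add_assoc, hmul]
end

section
/- Let V be a finite-dimensional vector space over the field Z/2 with finitely many elements, let B be a symmetric bilinear form on V with values in Z/2, let q : V → Z/4 be a quadratic enhancement of B, and let c ∈ V. Then in the complex numbers, Σ_{x ∈ V} i^{q(x) + 2·B(c,x)} = i^{−q(c)} · Σ_{x ∈ V} i^{q(x)}, where i^b for b ∈ Z/4 is well defined since i⁴ = 1, and 2· denotes the homomorphism Z/2 → Z/4 sending 1 to 2. -/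
/-- The complex number `i^b` associated to `b : ZMod 4`; well defined since `i⁴ = 1`. -/
def ipow : ZMod 4 → ℂ := fun b => Complex.I ^ b.val

/-- Gauss-sum identity for a quadratic enhancement `q : V → ZMod 4` of a symmetric
bilinear form `B` over `ZMod 2`:
`Σ_x i^(q x + 2·B c x) = i^(-(q c)) · Σ_x i^(q x)`. -/
theorem stmt_12 {V : Type*} [AddCommGroup V] [Module (ZMod 2) V]
    [FiniteDimensional (ZMod 2) V] [Fintype V]
    (B : LinearMap.BilinForm (ZMod 2) V) (hB : ∀ x y, B x y = B y x)
    (q : V → ZMod 4) (hq : ∀ x y, q (x + y) = q x + q y + twoMul (B x y)) (c : V) :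
    ∑ x : V, ipow (q x + twoMul (B c x)) = ipow (-(q c)) * ∑ x : V, ipow (q x) := by
  have hadd : ∀ a b : ZMod 4, ipow (a + b) = ipow a * ipow b := by
    intro a b
    unfold ipow
    rw [← pow_add, ZMod.val_add, ← Complex.I_pow_eq_pow_mod]
  rw [Finset.mul_sum, ← Equiv.sum_comp (Equiv.addLeft c) (fun x => ipow (-(q c)) * ipow (q x))]
  refine Finset.sum_congr rfl fun x _ => ?_
  rw [Equiv.coe_addLeft, ← hadd, hq]
  congr 1
  ring
end

section
/- Let V be a finite-dimensional vector space over the field Z/2 with finitely many elements and dimension n, let B be a nondegenerate symmetric bilinear form on V with values in Z/2 (i.e., for every x ≠ 0 there exists y with B(x,y) = 1), and let q be a quadratic form refining B. Then (Σ_{x ∈ V} (−1)^{q(x)})² = 2^n, where (−1)^a for a ∈ Z/2 is the well-defined sign obtained by lifting a to {0,1}. In particular n is even and Σ_{x ∈ V} (−1)^{q(x)} = ±2^{n/2}. -/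
theorem signZMod2_add (a b : ZMod 2) : signZMod2 (a + b) = signZMod2 a * signZMod2 b := by
  revert a b
  decide

/-- For a quadratic form `q` refining a nondegenerate symmetric bilinear form `B`
over `ZMod 2` on a space of dimension `n`, the Gauss sum `Σ_x (-1)^(q x)` squares to
`2 ^ n`; in particular `n` is even and the Gauss sum equals `± 2 ^ (n / 2)`. -/
theorem stmt_13 {V : Type*} [AddCommGroup V] [Module (ZMod 2) V]
    [FiniteDimensional (ZMod 2) V] [Fintype V]
    (B : LinearMap.BilinForm (ZMod 2) V) (hB : ∀ x y, B x y = B y x)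
    (hBnd : ∀ x : V, x ≠ 0 → ∃ y, B x y = 1)
    (q : V → ZMod 2) (hq : ∀ x y, q (x + y) = q x + q y + B x y) :
    (∑ x : V, signZMod2 (q x)) ^ 2 = 2 ^ Module.finrank (ZMod 2) V ∧
    Even (Module.finrank (ZMod 2) V) ∧
    ((∑ x : V, signZMod2 (q x)) = 2 ^ (Module.finrank (ZMod 2) V / 2) ∨
      (∑ x : V, signZMod2 (q x)) = -2 ^ (Module.finrank (ZMod 2) V / 2)) := by
  classical
  have hq0 : q 0 = 0 := by
    have h := hq 0 0
    simpa using h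
  have hinner : ∀ z : V, z ≠ 0 → ∑ x : V, signZMod2 (B x z) = 0 := by
    intro z hz
    obtain ⟨w, hw⟩ := hBnd z hz
    have h1 : ∑ x : V, signZMod2 (B (x + w) z) = ∑ x : V, signZMod2 (B x z) :=
      Equiv.sum_comp (Equiv.addRight w) (fun x => signZMod2 (B x z))
    have h2 : ∀ x : V, signZMod2 (B (x + w) z) = - signZMod2 (B x z) := by
      intro x
      have h3 : signZMod2 1 = -1 := by decide
      rw [map_add, LinearMap.add_apply, signZMod2_add, hB w z, hw, h3]
      ring
    simp only [h2, Finset.sum_neg_distrib] at h1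
    omega
  have hcard : (Fintype.card V : ℤ) = 2 ^ Module.finrank (ZMod 2) V := by
    rw [Module.card_eq_pow_finrank (K := ZMod 2) (V := V), ZMod.card]
    push_cast
    rfl
  have hsq : (∑ x : V, signZMod2 (q x)) ^ 2 = 2 ^ Module.finrank (ZMod 2) V := by
    have hterm : ∀ x z : V, signZMod2 (q x) * signZMod2 (q (x + z))
        = signZMod2 (q z) * signZMod2 (B x z) := by
      intro x z
      rw [hq, ← signZMod2_add, ← signZMod2_add]
      congr 1
      have : q x + q x = 0 := CharTwo.add_self_eq_zero _
      linear_combination this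
    calc (∑ x : V, signZMod2 (q x)) ^ 2
        = ∑ x : V, ∑ y : V, signZMod2 (q x) * signZMod2 (q y) := by
          rw [sq, Finset.sum_mul_sum]
      _ = ∑ x : V, ∑ z : V, signZMod2 (q x) * signZMod2 (q (x + z)) := by
          refine Finset.sum_congr rfl fun x _ => ?_
          exact (Equiv.sum_comp (Equiv.addLeft x)
            (fun y => signZMod2 (q x) * signZMod2 (q y))).symm
      _ = ∑ z : V, signZMod2 (q z) * ∑ x : V, signZMod2 (B x z) := by
          simp only [hterm]
          rw [Finset.sum_comm]
          simp only [Finset.mul_sum]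
      _ = signZMod2 (q 0) * ∑ x : V, signZMod2 (B x 0) := by
          refine Finset.sum_eq_single 0 (fun z _ hz => ?_) (by simp)
          rw [hinner z hz, mul_zero]
      _ = 2 ^ Module.finrank (ZMod 2) V := by
          have h0 : signZMod2 0 = 1 := by decide
          simp [hq0, h0, hcard]
  generalize (∑ x : V, signZMod2 (q x)) = S at hsq ⊢
  generalize Module.finrank (ZMod 2) V = n at hsq ⊢
  have heven : Even n := by
    have h1 : S.natAbs ^ 2 = 2 ^ n := by
      rw [← Int.natAbs_pow, hsq, Int.natAbs_pow]
      rfl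
    obtain ⟨k, _, hk⟩ := (Nat.dvd_prime_pow Nat.prime_two).1
      (h1 ▸ dvd_pow_self S.natAbs two_ne_zero)
    rw [hk, ← pow_mul] at h1
    have := Nat.pow_right_injective le_rfl h1
    exact ⟨k, by omega⟩
  refine ⟨hsq, heven, ?_⟩
  apply sq_eq_sq_iff_eq_or_eq_neg.1
  rw [hsq, ← pow_mul, Nat.div_mul_cancel heven.two_dvd]
end
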